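/- Let P and Q be probability measures on ℝ^d with P ≪ Q and R(P‖Q) < ∞. Then for every ε > 0 there exists a two-hidden-layer ReLU network T : ℝ^d → ℝ, bounded on ℝ^d, such that R(P‖Q) − ( E^P[T] − log E^Q[e^T] ) < ε. -/

import Mathlib

open MeasureTheory
open scoped RealInnerProductSpace BigOperators

/-- A two-hidden-layer ReLU network `ℝ^d → ℝ`:
`T(x) = c + Σ_j λ_j · max(0, b_j + Σ_i w_{ji} · max(0, ⟨β_i, x⟩ + γ_i))`. -/
def IsTwoHiddenLayerReLU {d : ℕ} (T : EuclideanSpace ℝ (Fin d) → ℝ) : Prop :=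
  ∃ (m₁ m₂ : ℕ) (c : ℝ) (lam b : Fin m₂ → ℝ) (w : Fin m₂ → Fin m₁ → ℝ)
    (β : Fin m₁ → EuclideanSpace ℝ (Fin d)) (γ : Fin m₁ → ℝ),
    ∀ x, T x = c + ∑ j, lam j * max 0 (b j + ∑ i, w j i * max 0 (⟪β i, x⟫ + γ i))

/-- One-hidden-layer ReLU networks. -/
def shallowNets (d : ℕ) : Submodule ℝ (EuclideanSpace ℝ (Fin d) → ℝ) :=
  Submodule.span ℝ (Set.range fun p : EuclideanSpace ℝ (Fin d) × ℝ =>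
    fun x => max 0 (⟪p.1, x⟫ + p.2))

lemma relu_mem_shallow {d : ℕ} (β : EuclideanSpace ℝ (Fin d)) (γ : ℝ) :
    (fun x => max 0 (⟪β, x⟫ + γ)) ∈ shallowNets d :=
  Submodule.subset_span ⟨(β, γ), rfl⟩

lemma const_mem_shallow {d : ℕ} (c : ℝ) :
    (fun _ => c) ∈ shallowNets d := by
  have := (shallowNets d).smul_mem c (relu_mem_shallow (d := d) 0 1)
  convert this using 1
  ext x; simp

lemma continuous_of_mem_shallow {d : ℕ} {N : EuclideanSpace ℝ (Fin d) → ℝ}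
    (h : N ∈ shallowNets d) : Continuous N := by
  induction h using Submodule.span_induction with
  | mem x h => obtain ⟨p, rfl⟩ := h; fun_prop
  | zero => exact continuous_zero
  | add x y _ _ hx hy => exact hx.add hy
  | smul a x _ hx => exact hx.const_smul a

/-- Clamped shallow networks are two-hidden-layer networks. -/
lemma clamp_isTwo {d : ℕ} {N : EuclideanSpace ℝ (Fin d) → ℝ}
    (h : N ∈ shallowNets d) (M : ℝ) (hM : 0 ≤ M) :
    IsTwoHiddenLayerReLU (fun x => max (-M) (min M (N x))) := by
  obtain ⟨n, f, g, rfl⟩ := Submodule.mem_span_set'.1 h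
  choose p hp using fun i => (g i).2
  refine ⟨n, 2, -M, ![1, -1], ![M, -M], fun _ => f, fun i => (p i).1, fun i => (p i).2, ?_⟩
  intro x
  have e : (∑ i, f i • (g i : EuclideanSpace ℝ (Fin d) → ℝ)) x
      = ∑ i, f i * max 0 (⟪(p i).1, x⟫ + (p i).2) := by
    simp [Finset.sum_apply, ← hp]
  beta_reduce
  rw [e]
  simp only [Fin.sum_univ_two, Matrix.cons_val_zero, Matrix.cons_val_one]
  generalize ∑ i, f i * max 0 (⟪(p i).1, x⟫ + (p i).2) = y
  rcases le_total y M with h1 | h1 <;> rcases le_total (-M) y with h2 | h2 <;>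
    simp [max_def, min_def] <;> split_ifs <;> linarith

lemma ridge_step {d : ℕ} (β : EuclideanSpace ℝ (Fin d)) (f : ℝ → ℝ) (a h ε : ℝ) (hh : 0 < h)
    (n : ℕ)
    (hf : ∀ s t, a ≤ s → s ≤ t → t ≤ s + h → t ≤ a + n * h → |f t - f s| ≤ ε) :
    ∃ N ∈ shallowNets d, (∀ x, a ≤ ⟪β, x⟫ → ⟪β, x⟫ ≤ a + n * h → |N x - f ⟪β, x⟫| ≤ 2 * ε) ∧
      (∀ x, a + n * h ≤ ⟪β, x⟫ → N x = f (a + n * h)) := by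
  induction n with
  | zero =>
    refine ⟨fun _ => f a, const_mem_shallow _, ?_, ?_⟩
    · intro x h1 h2
      have : ⟪β, x⟫ = a := by simp at h2; linarith
      have h3 := hf a a le_rfl le_rfl (by linarith) (by simp)
      have := (abs_nonneg _).trans h3
      simp_all
    · intro x _; simp
  | succ n ih =>
    obtain ⟨N, hN, h1, h2⟩ := ih (fun s t a1 a2 a3 a4 => hf s t a1 a2 a3 (by
      push_cast; nlinarith))
    set b := a + n * h with hb
    have hb' : a + ((n + 1 : ℕ) : ℝ) * h = b + h := by rw [hb]; push_cast; ring
    rw [hb'] at hf ⊢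
    have hab : a ≤ b := by rw [hb]; have : (0:ℝ) ≤ n * h := by positivity
                           linarith
    have hD := hf b (b + h) hab (by linarith) le_rfl le_rfl
    refine ⟨N + (f (b + h) - f b) • ((fun x => max 0 (⟪h⁻¹ • β, x⟫ + (- b / h)))
      - (fun x => max 0 (⟪h⁻¹ • β, x⟫ + (- b / h - 1)))), ?_, ?_, ?_⟩
    · exact add_mem hN (Submodule.smul_mem _ _ (sub_mem (relu_mem_shallow _ _)
        (relu_mem_shallow _ _)))
    all_goals
      intro x
      have key : ⟪h⁻¹ • β, x⟫ + (- b / h) = (⟪β, x⟫ - b) / h := by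
        rw [real_inner_smul_left]; field_simp; ring
      have key2 : ⟪h⁻¹ • β, x⟫ + (- b / h - 1) = (⟪β, x⟫ - b) / h - 1 := by
        rw [← key]; ring
      simp only [Pi.add_apply, Pi.smul_apply, Pi.sub_apply, key, key2, smul_eq_mul]
      have h1 := h1 x
      have h2 := h2 x
      generalize ⟪β, x⟫ = t at *
      generalize N x = y at *
    · intro a1 a2
      rcases le_total t b with h3 | h3
      · have : (t - b) / h ≤ 0 := div_nonpos_of_nonpos_of_nonneg (by linarith) hh.le
        rw [max_eq_left this, max_eq_left (by linarith)]
        simpa using h1 a1 h3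
      · have u0 : 0 ≤ (t - b) / h := div_nonneg (by linarith) hh.le
        have u1 : (t - b) / h ≤ 1 := by rw [div_le_one hh]; linarith
        rw [max_eq_right u0, max_eq_left (by linarith), h2 h3]
        have := hf b t hab h3 a2 a2
        generalize (t - b) / h = u at *
        have e1 : |(f (b + h) - f b) * (u - 0)| ≤ ε := by
          rw [abs_mul, sub_zero, abs_of_nonneg u0]
          nlinarith [abs_nonneg (f (b + h) - f b)]
        rw [abs_le] at *
        constructor <;> linarith [e1.1, e1.2, this.1, this.2]
    · intro a1
      have u1 : 1 ≤ (t - b) / h := by rw [one_le_div hh]; linarith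
      rw [h2 (by linarith), max_eq_right (by linarith), max_eq_right (by linarith)]
      ring

lemma ridge_approx {d : ℕ} (β : EuclideanSpace ℝ (Fin d)) (f : ℝ → ℝ) (hf : Continuous f)
    (K : Set (EuclideanSpace ℝ (Fin d))) (hK : IsCompact K) (ε : ℝ) (hε : 0 < ε) :
    ∃ N ∈ shallowNets d, ∀ x ∈ K, |N x - f ⟪β, x⟫| ≤ ε := by
  obtain ⟨A, hA⟩ := hK.exists_bound_of_continuousOn (f := fun x => ⟪β, x⟫) (by fun_prop)
  have hu := (isCompact_Icc (a := -A) (b := A + 1)).uniformContinuousOn_of_continuous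
    hf.continuousOn
  rw [Metric.uniformContinuousOn_iff_le] at hu
  obtain ⟨δ, hδ, H⟩ := hu (ε / 2) (by positivity)
  set h := min δ 1 with hh
  have h0 : 0 < h := by positivity
  have hn : ∃ n : ℕ, A ≤ -A + n * h ∧ -A + n * h ≤ A + 1 ∨ A < -A := by
    by_cases hA0 : A < -A
    · exact ⟨0, Or.inr hA0⟩
    refine ⟨⌈2 * A / h⌉₊, Or.inl ⟨?_, ?_⟩⟩
    · have := Nat.le_ceil (2 * A / h)
      rw [div_le_iff₀ h0] at this; linarith
    · have := Nat.ceil_lt_add_one (a := 2 * A / h) (div_nonneg (by linarith) h0.le)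
      have h1 : h ≤ 1 := min_le_right _ _
      have : (⌈2 * A / h⌉₊ : ℝ) * h ≤ (2 * A / h + 1) * h := by gcongr
      rw [add_mul, div_mul_cancel₀ _ h0.ne'] at this
      linarith
  obtain ⟨n, ⟨hn1, hn2⟩ | hn⟩ := hn
  · obtain ⟨N, hN, h1, -⟩ := ridge_step β f (-A) h (ε / 2) h0 n (by
      intro s t a1 a2 a3 a4
      refine H t ⟨by linarith, by linarith⟩ s ⟨by linarith, by linarith⟩ ?_
      rw [Real.dist_eq, abs_of_nonneg (by linarith)]
      linarith [min_le_left δ 1])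
    refine ⟨N, hN, fun x hx => ?_⟩
    have := abs_le.1 (hA x hx)
    refine (h1 x this.1 (this.2.trans hn1)).trans (by linarith)
  · refine ⟨0, zero_mem _, fun x hx => ?_⟩
    have := abs_le.1 (hA x hx)
    linarith [this.1, this.2]

/-- Universal approximation on compacts. -/
lemma shallow_universal {d : ℕ} (g : EuclideanSpace ℝ (Fin d) → ℝ) (hg : Continuous g)
    (K : Set (EuclideanSpace ℝ (Fin d))) (hK : IsCompact K) (ε : ℝ) (hε : 0 < ε) :
    ∃ N ∈ shallowNets d, ∀ x ∈ K, |N x - g x| ≤ ε := by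
  have : CompactSpace K := isCompact_iff_compactSpace.1 hK
  let e : EuclideanSpace ℝ (Fin d) → C(K, ℝ) := fun β =>
    ⟨fun x => Real.exp ⟪β, (x : EuclideanSpace ℝ (Fin d))⟫, by fun_prop⟩
  let S : Submonoid C(K, ℝ) :=
    { carrier := Set.range e
      one_mem' := ⟨0, by ext x; simp [e]⟩
      mul_mem' := by
        rintro _ _ ⟨b, rfl⟩ ⟨c, rfl⟩
        refine ⟨b + c, ?_⟩
        ext x; simp [e, inner_add_left, Real.exp_add] }
  let A := Algebra.adjoin ℝ (S : Set C(K, ℝ))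
  have hsep : A.SeparatesPoints := by
    intro x y hxy
    refine ⟨e ((x : EuclideanSpace ℝ (Fin d)) - y), ⟨e _, Algebra.subset_adjoin ⟨_, rfl⟩, rfl⟩, ?_⟩
    intro h
    have h := Real.exp_injective h
    rw [← sub_eq_zero, ← inner_sub_right, inner_self_eq_zero, sub_eq_zero] at h
    exact hxy (Subtype.ext h)
  have happ : ∀ u ∈ A, ∀ ε > 0, ∃ N ∈ shallowNets d, ∀ x : K, |N x - u x| ≤ ε := by
    intro u hu0
    have hu : u ∈ Submodule.span ℝ (S : Set C(K, ℝ)) := by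
      have := Algebra.adjoin_eq_span ℝ (S : Set C(K, ℝ))
      rw [Submonoid.closure_eq] at this
      rw [← this]; exact hu0
    clear hu0
    induction hu using Submodule.span_induction with
    | mem u h =>
      obtain ⟨b, rfl⟩ := h
      intro ε hε
      obtain ⟨N, hN, h⟩ := ridge_approx b Real.exp Real.continuous_exp K hK ε hε
      exact ⟨N, hN, fun x => h x x.2⟩
    | zero => intro ε hε; exact ⟨0, zero_mem _, fun x => by simpa using hε.le⟩
    | add u v _ _ hu hv =>
      intro ε hε
      obtain ⟨N, hN, h⟩ := hu (ε / 2) (by positivity)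
      obtain ⟨N', hN', h'⟩ := hv (ε / 2) (by positivity)
      refine ⟨N + N', add_mem hN hN', fun x => ?_⟩
      have h := abs_le.1 (h x)
      have h' := abs_le.1 (h' x)
      simp only [Pi.add_apply, ContinuousMap.add_apply]
      rw [abs_le]
      constructor <;> linarith [h.1, h.2, h'.1, h'.2]
    | smul a u _ hu =>
      intro ε hε
      obtain ⟨N, hN, h⟩ := hu (ε / (|a| + 1)) (by positivity)
      refine ⟨a • N, Submodule.smul_mem _ _ hN, fun x => ?_⟩
      simp only [Pi.smul_apply, ContinuousMap.smul_apply, smul_eq_mul, ← mul_sub, abs_mul]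
      have h := h x
      rw [le_div_iff₀ (by positivity)] at h
      nlinarith [abs_nonneg (N x - u x)]
  obtain ⟨u, hu⟩ := ContinuousMap.exists_mem_subalgebra_near_continuousMap_of_separatesPoints A hsep
    ⟨fun x : K => g x, by fun_prop⟩ (ε / 2) (by positivity)
  obtain ⟨N, hN, h⟩ := happ u u.2 (ε / 2) (by positivity)
  refine ⟨N, hN, fun x hx => ?_⟩
  have h1 := abs_le.1 (h ⟨x, hx⟩)
  have h2 := abs_le.1 ((ContinuousMap.norm_coe_le_norm _ ⟨x, hx⟩).trans hu.le)
  simp only [ContinuousMap.sub_apply, ContinuousMap.coe_mk] at h2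
  rw [abs_le]
  constructor <;> linarith [h1.1, h1.2, h2.1, h2.2]

lemma clamp_abs_le (M y : ℝ) (hM : 0 ≤ M) : |max (-M) (min M y)| ≤ M := by
  rw [abs_le]
  exact ⟨le_max_left _ _, max_le (by linarith) (min_le_left _ _)⟩

lemma clamp_sub_le (M y z : ℝ) (hz : |z| ≤ M) : |max (-M) (min M y) - z| ≤ |y - z| := by
  rw [abs_le] at hz
  obtain ⟨h1, h2⟩ := hz
  have a := le_abs_self (y - z)
  have b := neg_abs_le (y - z)
  have c := abs_nonneg (y - z)
  rw [abs_le]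
  rcases le_total y M with h3 | h3 <;> rcases le_total (-M) y with h4 | h4 <;>
    simp [max_def, min_def] <;> split_ifs <;> constructor <;> linarith

lemma shallow_L1 {d : ℕ} (μ : Measure (EuclideanSpace ℝ (Fin d))) [IsFiniteMeasure μ]
    (f : EuclideanSpace ℝ (Fin d) → ℝ) (hf : Measurable f) (M : ℝ) (hM : 0 ≤ M)
    (hfM : ∀ x, |f x| ≤ M) (ε : ℝ) (hε : 0 < ε) :
    ∃ N ∈ shallowNets d, ∫ x, |max (-M) (min M (N x)) - f x| ∂μ ≤ ε := by
  have hfi : Integrable f μ := Integrable.of_bound hf.aestronglyMeasurable M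
    (ae_of_all _ hfM)
  obtain ⟨g, hg, hgi⟩ := hfi.exists_boundedContinuous_integral_sub_le (ε := ε / 3) (by positivity)
  obtain ⟨K, -, hK, hKμ⟩ := MeasurableSet.univ.exists_isCompact_sdiff_lt (μ := μ)
    (measure_ne_top _ _) (ε := ENNReal.ofReal (ε / 3 / (2 * M + 1)))
    (by simp only [ne_eq, ENNReal.ofReal_eq_zero, not_le]; positivity)
  obtain ⟨N, hN, hNg⟩ := shallow_universal g g.continuous K hK (ε / 3 / (μ.real Set.univ + 1))
    (by positivity)
  refine ⟨N, hN, ?_⟩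
  rw [← Set.compl_eq_univ_sdiff] at hKμ
  have hKμ' : μ.real Kᶜ ≤ ε / 3 / (2 * M + 1) :=
    ENNReal.toReal_le_of_le_ofReal (by positivity) hKμ.le
  have hNc := continuous_of_mem_shallow hN
  have hfg : Integrable (fun x => ‖f x - g x‖) μ := (hfi.sub hgi).norm
  have hind : Integrable (Set.indicator Kᶜ (fun _ => 2 * M)) μ :=
    (integrable_const _).indicator hK.measurableSet.compl
  calc ∫ x, |max (-M) (min M (N x)) - f x| ∂μ
      ≤ ∫ x, (ε / 3 / (μ.real Set.univ + 1) + ‖f x - g x‖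
          + Set.indicator Kᶜ (fun _ => 2 * M) x) ∂μ := by
        refine integral_mono_of_nonneg (ae_of_all _ fun x => abs_nonneg _)
          (((integrable_const _).add hfg).add hind) (ae_of_all _ fun x => ?_)
        have hd : 0 < ε / 3 / (μ.real Set.univ + 1) := by positivity
        have hn := norm_nonneg (f x - g x)
        by_cases hx : x ∈ K
        · simp only [Set.mem_compl_iff, hx, not_true_eq_false, not_false_eq_true,
            Set.indicator_of_notMem, add_zero]
          refine (clamp_sub_le M _ _ (hfM x)).trans ?_
          have h1 := hNg x hx
          have h2 : |N x - f x| ≤ |N x - g x| + |g x - f x| := abs_sub_le _ _ _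
          rw [abs_sub_comm (g x)] at h2
          rw [Real.norm_eq_abs]
          linarith
        · simp only [Set.mem_compl_iff, hx, not_false_eq_true,
            Set.indicator_of_mem]
          have h1 := abs_sub (max (-M) (min M (N x))) (f x)
          have h2 := clamp_abs_le M (N x) hM
          have h3 := hfM x
          linarith
    _ = ε / 3 / (μ.real Set.univ + 1) * μ.real Set.univ + ∫ x, ‖f x - g x‖ ∂μ
          + μ.real Kᶜ * (2 * M) := by
        have hs : Integrable (fun x => ε / 3 / (μ.real Set.univ + 1) + ‖f x - g x‖) μ :=
          (integrable_const _).add hfg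
        rw [integral_add hs hind, integral_add (integrable_const _) hfg,
          integral_indicator_const _ hK.measurableSet.compl, integral_const]
        simp [mul_comm]
    _ ≤ ε / 3 + ε / 3 + ε / 3 := by
        gcongr
        · rw [div_mul_eq_mul_div, div_le_iff₀ (by positivity)]
          nlinarith
        · rw [le_div_iff₀ (by positivity)] at hKμ'
          nlinarith [measureReal_nonneg (μ := μ) (s := Kᶜ)]
    _ = ε := by ring

lemma exp_sub_le (M a b : ℝ) (ha : a ≤ M) (hb : b ≤ M) :
    Real.exp a ≤ Real.exp b + Real.exp M * |a - b| := by
  rcases le_total a b with h | h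
  · have := Real.exp_le_exp.2 h
    have : 0 ≤ Real.exp M * |a - b| := by positivity
    linarith
  · rw [abs_of_nonneg (by linarith)]
    have h1 : Real.exp b = Real.exp a * Real.exp (b - a) := by rw [← Real.exp_add]; ring_nf
    have h2 := Real.add_one_le_exp (b - a)
    have h3 := Real.exp_le_exp.2 ha
    have h4 := Real.exp_pos a
    nlinarith

/-- Stability of the Donsker-Varadhan functional under `L¹(P + Q)` perturbations. -/
lemma DV_stable {α : Type*} [MeasurableSpace α] (P Q : Measure α)
    [IsProbabilityMeasure P] [IsProbabilityMeasure Q]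
    (f T : α → ℝ) (hf : Measurable f) (hT : Measurable T) (M : ℝ)
    (hfM : ∀ x, |f x| ≤ M) (hTM : ∀ x, |T x| ≤ M) (δ : ℝ)
    (h : ∫ x, |T x - f x| ∂(P + Q) ≤ δ) :
    (∫ x, f x ∂P) - Real.log (∫ x, Real.exp (f x) ∂Q) - (1 + Real.exp (2 * M)) * δ ≤
      (∫ x, T x ∂P) - Real.log (∫ x, Real.exp (T x) ∂Q) := by
  have bi : ∀ (μ : Measure α) [IsFiniteMeasure μ] (u : α → ℝ), Measurable u → (∀ x, |u x| ≤ M) →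
      Integrable u μ := fun μ _ u hu hb =>
    Integrable.of_bound hu.aestronglyMeasurable M (ae_of_all _ hb)
  have be : ∀ (u : α → ℝ), Measurable u → (∀ x, |u x| ≤ M) →
      Integrable (fun x => Real.exp (u x)) Q := fun u hu hb =>
    Integrable.of_bound hu.exp.aestronglyMeasurable (Real.exp M) (ae_of_all _ fun x => by
      rw [Real.norm_eq_abs, Real.abs_exp]
      exact Real.exp_le_exp.2 (abs_le.1 (hb x)).2)
  have bl : ∀ (u : α → ℝ), Measurable u → (∀ x, |u x| ≤ M) →
      Real.exp (-M) ≤ ∫ x, Real.exp (u x) ∂Q := fun u hu hb => by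
    have := integral_mono (μ := Q) (integrable_const (Real.exp (-M))) (be u hu hb)
      (fun x => Real.exp_le_exp.2 (abs_le.1 (hb x)).1)
    simpa using this
  have iP : Integrable (fun x => |T x - f x|) P := ((bi P T hT hTM).sub (bi P f hf hfM)).abs
  have iQ : Integrable (fun x => |T x - f x|) Q := ((bi Q T hT hTM).sub (bi Q f hf hfM)).abs
  rw [integral_add_measure iP iQ] at h
  have nP : 0 ≤ ∫ x, |T x - f x| ∂P := integral_nonneg fun x => abs_nonneg _
  have nQ : 0 ≤ ∫ x, |T x - f x| ∂Q := integral_nonneg fun x => abs_nonneg _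
  have h1 : (∫ x, f x ∂P) - δ ≤ ∫ x, T x ∂P := by
    have : (∫ x, f x ∂P) - (∫ x, |T x - f x| ∂P) ≤ ∫ x, T x ∂P := by
      rw [← integral_sub (bi P f hf hfM) iP]
      refine integral_mono ((bi P f hf hfM).sub iP) (bi P T hT hTM) fun x => ?_
      have := neg_abs_le (T x - f x)
      linarith
    linarith
  have h2 : ∫ x, Real.exp (T x) ∂Q ≤ (∫ x, Real.exp (f x) ∂Q) + Real.exp M * δ := by
    have : ∫ x, Real.exp (T x) ∂Q ≤
        (∫ x, Real.exp (f x) ∂Q) + Real.exp M * ∫ x, |T x - f x| ∂Q := by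
      rw [← integral_const_mul, ← integral_add (be f hf hfM) (iQ.const_mul _)]
      exact integral_mono (be T hT hTM) ((be f hf hfM).add (iQ.const_mul _)) fun x =>
        exp_sub_le M _ _ (abs_le.1 (hTM x)).2 (abs_le.1 (hfM x)).2
    have : Real.exp M * ∫ x, |T x - f x| ∂Q ≤ Real.exp M * δ := by gcongr; linarith
    linarith
  have hA := bl f hf hfM
  have hB := bl T hT hTM
  set A := ∫ x, Real.exp (f x) ∂Q
  set B := ∫ x, Real.exp (T x) ∂Q
  have eM := Real.exp_pos (-M)
  have hA0 : 0 < A := by linarith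
  have hB0 : 0 < B := by linarith
  have hδ : 0 ≤ δ := by linarith
  have h3 : Real.log B ≤ Real.log A + Real.exp (2 * M) * δ := by
    have h4 : Real.log (B / A) ≤ B / A - 1 := Real.log_le_sub_one_of_pos (by positivity)
    rw [Real.log_div hB0.ne' hA0.ne'] at h4
    have h5 : B / A - 1 ≤ Real.exp (2 * M) * δ := by
      rw [sub_le_iff_le_add, div_le_iff₀ hA0]
      have e1 : Real.exp (2 * M) * Real.exp (-M) = Real.exp M := by
        rw [← Real.exp_add]; ring_nf
      have : Real.exp M * δ ≤ Real.exp (2 * M) * A * δ := by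
        rw [← e1]; gcongr
      nlinarith
    linarith
  linarith

/-- Truncation of the log likelihood ratio. -/
lemma truncation {α : Type*} [MeasurableSpace α] (P Q : Measure α)
    [IsProbabilityMeasure P] [IsProbabilityMeasure Q] (hPQ : P ≪ Q)
    (hRfin : Integrable (fun x => Real.log ((P.rnDeriv Q) x).toReal) P)
    (ε : ℝ) (hε : 0 < ε) :
    ∃ (f : α → ℝ) (M : ℝ), Measurable f ∧ 0 ≤ M ∧ (∀ x, |f x| ≤ M) ∧
      (∫ x, Real.log ((P.rnDeriv Q) x).toReal ∂P) - ε <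
        (∫ x, f x ∂P) - Real.log (∫ x, Real.exp (f x) ∂Q) := by
  set r : α → ℝ := fun x => ((P.rnDeriv Q) x).toReal with hr
  have hrm : Measurable r := (Measure.measurable_rnDeriv P Q).ennreal_toReal
  have hr0 : ∀ x, 0 ≤ r x := fun x => ENNReal.toReal_nonneg
  have hrpos : ∀ᵐ x ∂P, 0 < r x := by
    filter_upwards [Measure.rnDeriv_pos hPQ, hPQ.ae_le (Measure.rnDeriv_ne_top P Q)] with x h1 h2
    exact ENNReal.toReal_pos h1.ne' h2
  let c : ℕ → α → ℝ := fun n x => max (Real.exp (-n)) (min (Real.exp n) (r x))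
  have hcm : ∀ n, Measurable (c n) := fun n => by fun_prop
  have hcl : ∀ (n : ℕ) (x : α), Real.exp (-n) ≤ c n x := fun n x => le_max_left _ _
  have hcp : ∀ (n : ℕ) (x : α), 0 < c n x := fun n x => (Real.exp_pos _).trans_le (hcl n x)
  have hcu : ∀ (n : ℕ) (x : α), c n x ≤ Real.exp n := fun n x =>
    max_le (Real.exp_le_exp.2 (by have : (0:ℝ) ≤ n := by positivity
                                  linarith)) (min_le_left _ _)
  let F : ℕ → α → ℝ := fun n x => Real.log (c n x)
  have hFm : ∀ n, Measurable (F n) := fun n => (hcm n).log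
  have hFb : ∀ (n : ℕ) (x : α), |F n x| ≤ n := fun n x => by
    rw [abs_le]
    exact ⟨(Real.le_log_iff_exp_le (hcp n x)).2 (hcl n x),
      (Real.log_le_iff_le_exp (hcp n x)).2 (hcu n x)⟩
  have hFe : ∀ n, ∀ x, 0 < r x → F n x = max (-(n:ℝ)) (min n (Real.log (r x))) := by
    intro n x hx
    have hmono : ∀ a b : ℝ, 0 < a → 0 < b → (Real.log a ≤ Real.log b ↔ a ≤ b) :=
      fun a b ha hb => Real.log_le_log_iff ha hb
    have e : r x = Real.exp (Real.log (r x)) := (Real.exp_log hx).symm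
    change Real.log (max (Real.exp (-n)) (min (Real.exp n) (r x))) = _
    rw [e, ← Real.exp_monotone.map_min, ← Real.exp_monotone.map_max, Real.log_exp, Real.log_exp]
  have hlim : Filter.Tendsto (fun n => ∫ x, F n x ∂P) Filter.atTop
      (nhds (∫ x, Real.log (r x) ∂P)) := by
    refine tendsto_integral_of_dominated_convergence (fun x => |Real.log (r x)|)
      (fun n => (hFm n).aestronglyMeasurable) hRfin.abs (fun n => ?_) ?_
    · filter_upwards [hrpos] with x hx
      rw [hFe n x hx, Real.norm_eq_abs]
      have hn : (0:ℝ) ≤ n := by positivity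
      have := clamp_sub_le n (Real.log (r x)) 0 (by simpa using hn)
      simpa using this
    · filter_upwards [hrpos] with x hx
      refine tendsto_const_nhds.congr' ?_
      filter_upwards [Filter.eventually_ge_atTop ⌈|Real.log (r x)|⌉₊] with n hn
      have hn := abs_le.1 (Nat.ceil_le.1 hn)
      rw [hFe n x hx, min_eq_right hn.2, max_eq_right hn.1]
  have hexp : Filter.Tendsto (fun n : ℕ => Real.exp (-(n:ℝ))) Filter.atTop (nhds 0) :=
    Real.tendsto_exp_neg_atTop_nhds_zero.comp tendsto_natCast_atTop_atTop
  have hl := hlim.sub hexp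
  rw [sub_zero] at hl
  obtain ⟨n, hn⟩ := (hl.eventually (lt_mem_nhds (show (∫ x, Real.log (r x) ∂P) - ε < _ by
    linarith))).exists
  refine ⟨F n, n, hFm n, by positivity, hFb n, hn.trans_le ?_⟩
  have hri : Integrable r Q := Measure.integrable_toReal_rnDeriv
  have hr1 : ∫ x, r x ∂Q = 1 := by
    rw [hr, Measure.integral_toReal_rnDeriv hPQ]; simp
  have hFc : (fun x => Real.exp (F n x)) = c n := by
    ext x; exact Real.exp_log (hcp n x)
  rw [hFc]
  have hci : Integrable (c n) Q := Integrable.of_bound (hcm n).aestronglyMeasurable (Real.exp n)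
    (ae_of_all _ fun x => by rw [Real.norm_eq_abs, abs_of_pos (hcp n x)]; exact hcu n x)
  have hC : ∫ x, c n x ∂Q ≤ 1 + Real.exp (-n) := by
    have := integral_mono hci (hri.add (integrable_const (Real.exp (-n)))) (fun x => ?_)
    · simp only [Pi.add_apply] at this
      rw [integral_add hri (integrable_const _), hr1] at this
      simpa using this
    · have := Real.exp_pos (-n)
      have := hr0 x
      exact max_le (by simp only [Pi.add_apply]; linarith)
        ((min_le_right _ _).trans (by simp only [Pi.add_apply]; linarith))
  have hC0 : 0 < ∫ x, c n x ∂Q := by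
    have := integral_mono (integrable_const (Real.exp (-n))) hci (fun x => hcl n x)
    simp only [integral_const, probReal_univ, smul_eq_mul, one_mul] at this
    exact (Real.exp_pos _).trans_le this
  have := Real.log_le_sub_one_of_pos hC0
  linarith

/-- If `P ≪ Q` and `R(P‖Q) < ∞`, then for every `ε > 0` there is a bounded
two-hidden-layer ReLU network `T` whose Donsker–Varadhan value is within `ε` of `R(P‖Q)`:
`R(P‖Q) − (E^P[T] − log E^Q[e^T]) < ε`. -/
theorem relu_DV_approximation_of_relative_entropy
    {d : ℕ} (P Q : Measure (EuclideanSpace ℝ (Fin d)))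
    [IsProbabilityMeasure P] [IsProbabilityMeasure Q]
    (hPQ : P ≪ Q)
    -- `R(P‖Q) = E^P[log (dP/dQ)] < ∞`
    (hRfin : Integrable (fun x => Real.log ((P.rnDeriv Q) x).toReal) P)
    (ε : ℝ) (hε : 0 < ε) :
    ∃ T : EuclideanSpace ℝ (Fin d) → ℝ, IsTwoHiddenLayerReLU T ∧
      (∃ C : ℝ, ∀ x, |T x| ≤ C) ∧
      (∫ x, Real.log ((P.rnDeriv Q) x).toReal ∂P)
        - ((∫ x, T x ∂P) - Real.log (∫ x, Real.exp (T x) ∂Q)) < ε := by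
  obtain ⟨f, M, hf, hM, hfM, hlt⟩ := truncation P Q hPQ hRfin (ε / 2) (by positivity)
  obtain ⟨N, hN, hL⟩ := shallow_L1 (P + Q) f hf M hM hfM (ε / 2 / (1 + Real.exp (2 * M)))
    (by positivity)
  have hNc := continuous_of_mem_shallow hN
  refine ⟨fun x => max (-M) (min M (N x)), clamp_isTwo hN M hM,
    ⟨M, fun x => clamp_abs_le M _ hM⟩, ?_⟩
  have := DV_stable P Q f (fun x => max (-M) (min M (N x))) hf
    (by fun_prop) M hfM
    (fun x => clamp_abs_le M _ hM) _ hL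
  rw [mul_div_cancel₀ _ (by positivity)] at this
  linarith
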